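/- arXiv:2605.15388 — 9 statements merged into one kernel-verified Lean document; each statement's English description precedes it below -/
import Mathlib

section
/- For every real number s, exp(s) ≤ s + exp(9s²/16). -/
theorem aux_exp_lower (u : ℝ) (hu : 0 ≤ u) : 1 + u + u ^ 2 / 2 + u ^ 3 / 6 ≤ Real.exp u := by
  have h := Real.sum_le_exp_of_nonneg hu 4
  simp [Finset.sum_range_succ, Nat.factorial] at h
  linarith

/-- For every real number `s`, `exp s ≤ s + exp (9 s² / 16)`. -/
theorem exp_le_add_exp_nine_sixteenth_sq (s : ℝ) :
    Real.exp s ≤ s + Real.exp (9 * s ^ 2 / 16) := by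
  have hl := aux_exp_lower (9 * s ^ 2 / 16) (by positivity)
  rcases le_total s 0 with h0 | h0
  · have h1 : Real.exp s ≤ 1 + s + s ^ 2 / 2 := by
      have h2 := Real.quadratic_le_exp_of_nonneg (x := -s) (by linarith)
      have h3 : Real.exp s * Real.exp (-s) = 1 := by rw [← Real.exp_add]; simp
      have h4 : 0 < Real.exp s := Real.exp_pos s
      have h5 : Real.exp s * (1 - s + s ^ 2 / 2) ≤ 1 := by nlinarith
      have h6 : 1 ≤ (1 + s + s ^ 2 / 2) * (1 - s + s ^ 2 / 2) := by nlinarith [sq_nonneg (s ^ 2)]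
      have h7 : 0 < 1 - s + s ^ 2 / 2 := by nlinarith [sq_nonneg s]
      exact le_of_mul_le_mul_right (h5.trans h6) h7
    have : 0 ≤ (9 * s ^ 2 / 16) ^ 2 := by positivity
    have : 0 ≤ (9 * s ^ 2 / 16) ^ 3 := by positivity
    nlinarith [sq_nonneg s]
  rcases le_total s 1 with h1 | h1
  · have h := Real.exp_bound' h0 h1 (n := 5) (by norm_num)
    simp [Finset.sum_range_succ, Nat.factorial] at h
    have hp : 0 ≤ 1/16 - s/6 + s^2*(81/512-1/24) - s^3/100 + s^4*(729/24576) := by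
      nlinarith [sq_nonneg (s^2 - 2/5), sq_nonneg (s - 3/5), sq_nonneg (s^2 - 3/5*s), sq_nonneg (s^2+s-24/25)]
    have := mul_nonneg (sq_nonneg s) hp
    nlinarith
  rcases le_total s (16/9) with h2 | h2
  · obtain ⟨t, rfl⟩ : ∃ t, s = 1 + t := ⟨s - 1, by ring⟩
    have ht : 0 ≤ t := by linarith
    have h := Real.exp_bound' ht (by linarith) (n := 3) (by norm_num)
    simp [Finset.sum_range_succ, Nat.factorial] at h
    have he := Real.exp_one_lt_d9
    have hb : Real.exp (1 + t) ≤ 2.7182818286 * (1 + t + t^2/2 + t^3*(2/9)) := by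
      rw [Real.exp_add]
      apply mul_le_mul he.le _ (Real.exp_pos _).le (by norm_num)
      linarith
    have a2 : 0 ≤ t^2 := by positivity
    have a3 : 0 ≤ t^3 := by positivity
    have a4 : 0 ≤ t^4 := by positivity
    have a5 : 0 ≤ t^5 := by positivity
    have a6 : 0 ≤ t^6 := by positivity
    nlinarith
  · have : Real.exp s ≤ Real.exp (9 * s ^ 2 / 16) := Real.exp_le_exp.2 (by nlinarith)
    linarith
end

section
/- Suppose ψ is integrable with E[ψ] ≤ μ and E[exp(ψ²/σ²)] ≤ 2. Then for every λ ≥ 0, E[exp(λψ)] ≤ exp(λμ + (3/4)·λ²σ²). -/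
open MeasureTheory

lemma aux_exp_bound (x : ℝ) : Real.exp x ≤ x + Real.exp (9 * x ^ 2 / 16) := by
  rcases le_total x 0 with hx | hx
  · have h1 : Real.exp x ≤ 1 + x + x ^ 2 / 2 := by
      have h := Real.quadratic_le_exp_of_nonneg (x := -x) (by linarith)
      have h3 : Real.exp x * Real.exp (-x) = 1 := by rw [← Real.exp_add]; simp
      have hp := Real.exp_pos x
      have h4 : Real.exp x * (1 + -x + (-x) ^ 2 / 2) ≤ 1 := by
        exact (mul_le_mul_of_nonneg_left h hp.le).trans h3.le
      have h5 : 0 < 1 + -x + (-x) ^ 2 / 2 := by nlinarith [sq_nonneg x]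
      by_contra hc
      push Not at hc
      nlinarith [mul_lt_mul_of_pos_right hc h5, sq_nonneg (x ^ 2)]
    have := Real.add_one_le_exp (9 * x ^ 2 / 16)
    nlinarith [sq_nonneg x]
  rcases le_total x 1 with hx1 | hx1
  · have h1 := Real.exp_bound' hx hx1 (n := 5) (by norm_num)
    have h2 := Real.sum_le_exp_of_nonneg (x := 9 * x ^ 2 / 16) (by positivity) 4
    simp [Finset.sum_range_succ, Nat.factorial] at h1 h2
    have hg : 0 ≤ 1/16 - x/6 + (81/512-1/24)*x^2 - x^3/100 + (729/4096/6)*x^4 := by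
      rcases le_total x (34/100) with h | h
      · nlinarith [pow_nonneg hx 4, mul_nonneg (sq_nonneg x) (sub_nonneg.2 h), sq_nonneg (x - 34/100)]
      · nlinarith [mul_nonneg (pow_nonneg hx 3) (sub_nonneg.2 h), sq_nonneg (x - 72/100)]
    have := mul_nonneg (sq_nonneg x) hg
    nlinarith
  rcases le_total x (16/9) with hx2 | hx2
  · obtain ⟨y, rfl⟩ : ∃ y, x = 1 + y := ⟨x - 1, by ring⟩
    have hy : 0 ≤ y := by linarith
    have h1 := Real.exp_bound' hy (by linarith) (n := 4) (by norm_num)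
    simp [Finset.sum_range_succ, Nat.factorial] at h1
    have h2 := Real.quadratic_le_exp_of_nonneg (x := 9 * y / 8 + 9 * y ^ 2 / 16) (by positivity)
    have h3 : (1.75 : ℝ) ≤ Real.exp (9 / 16) := by
      have := Real.sum_le_exp_of_nonneg (x := 9 / 16) (by positivity) 5
      simp [Finset.sum_range_succ, Nat.factorial] at this
      norm_num at this ⊢
      linarith
    have e1 : Real.exp (9 * (1 + y) ^ 2 / 16)
        = Real.exp (9 / 16) * Real.exp (9 * y / 8 + 9 * y ^ 2 / 16) := by
      rw [← Real.exp_add]; ring_nf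
    rw [e1, Real.exp_add]
    have h4 := mul_le_mul h3 h2 (by positivity) (by positivity)
    have h5 := mul_le_mul Real.exp_one_lt_d9.le h1 (by positivity) (by norm_num)
    nlinarith [pow_nonneg hy 2, pow_nonneg hy 3, pow_nonneg hy 4]
  · have : Real.exp x ≤ Real.exp (9 * x ^ 2 / 16) := Real.exp_le_exp.2 (by nlinarith)
    linarith

lemma aux_main {Ω : Type*} [MeasurableSpace Ω] (μ : Measure Ω) [IsProbabilityMeasure μ]
    (X : Ω → ℝ) (hX : Measurable X) (hint : Integrable X μ)
    (hE : Integrable (fun ω => Real.exp (X ω ^ 2)) μ)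
    (h2 : ∫ ω, Real.exp (X ω ^ 2) ∂μ ≤ 2) (k : ℝ) (hk : 0 ≤ k) :
    Integrable (fun ω => Real.exp (k * X ω)) μ ∧
    ∫ ω, Real.exp (k * X ω) ∂μ ≤ Real.exp (k * (∫ ω, X ω ∂μ) + 3 / 4 * k ^ 2) := by
  set m := ∫ ω, X ω ∂μ with hm
  have pw : ∀ k x : ℝ, Real.exp (k * x) ≤ Real.exp (k ^ 2 / 4) * Real.exp (x ^ 2) := by
    intro k x
    rw [← Real.exp_add]
    exact Real.exp_le_exp.2 (by nlinarith [sq_nonneg (k / 2 - x)])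
  have I : ∀ k : ℝ, Integrable (fun ω => Real.exp (k * X ω)) μ := by
    intro k
    refine (hE.const_mul (Real.exp (k ^ 2 / 4))).mono' (by fun_prop) (ae_of_all _ fun ω => ?_)
    rw [Real.norm_eq_abs, abs_of_pos (Real.exp_pos _)]
    exact pw k _
  refine ⟨I k, ?_⟩
  have big : ∀ k : ℝ, ∫ ω, Real.exp (k * X ω) ∂μ ≤ Real.exp (Real.log 2 + k ^ 2 / 4) := by
    intro k
    have := integral_mono (I k) (hE.const_mul (Real.exp (k ^ 2 / 4))) (fun ω => pw k (X ω))
    rw [integral_const_mul] at this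
    rw [Real.exp_add, Real.exp_log (by norm_num)]
    nlinarith [Real.exp_pos (k ^ 2 / 4)]
  have small : ∀ k : ℝ, 0 ≤ k → k ≤ 4 / 3 →
      ∫ ω, Real.exp (k * X ω) ∂μ ≤ k * m + 1 + 9 / 16 * k ^ 2 := by
    intro k h0 h1
    have hp : ∀ ω, Real.exp (k * X ω) ≤
        k * X ω + ((1 - 9 / 16 * k ^ 2) + 9 / 16 * k ^ 2 * Real.exp (X ω ^ 2)) := by
      intro ω
      have a := aux_exp_bound (k * X ω)
      have b := convexOn_exp.2 (Set.mem_univ 0) (Set.mem_univ (X ω ^ 2))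
        (show 0 ≤ 1 - 9 / 16 * k ^ 2 by nlinarith) (show 0 ≤ 9 / 16 * k ^ 2 by positivity) (by ring)
      simp only [smul_eq_mul, Real.exp_zero, mul_zero, zero_add, mul_one] at b
      have e : 9 * (k * X ω) ^ 2 / 16 = 9 / 16 * k ^ 2 * X ω ^ 2 := by ring
      rw [e] at a
      linarith
    have i1 := hint.const_mul k
    have i2 := hE.const_mul (9 / 16 * k ^ 2)
    have i3 : Integrable (fun _ : Ω => (1 - 9 / 16 * k ^ 2)) μ := integrable_const _
    have := integral_mono (I k) (i1.add (i3.add i2)) hp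
    rw [integral_add' i1 (i3.add i2), integral_add' i3 i2, integral_const_mul,
      integral_const_mul] at this
    simp only [integral_const, probReal_univ, one_smul] at this
    nlinarith [mul_le_mul_of_nonneg_left h2 (show 0 ≤ 9 / 16 * k ^ 2 by positivity)]
  have l2 := Real.log_two_lt_d9
  have l2' := Real.log_two_gt_d9
  have mlow : -(5 / 6) ≤ m := by
    have hp : ∀ ω, 2 * (1 - 25 / 36 - Real.log 2) + (-(10 / 3)) * X ω ≤ Real.exp (X ω ^ 2) := by
      intro ω
      have a := Real.add_one_le_exp (X ω ^ 2 - Real.log 2)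
      rw [Real.exp_sub, Real.exp_log (by norm_num)] at a
      nlinarith [sq_nonneg (X ω + 5 / 6)]
    have i1 := hint.const_mul (-(10 / 3))
    have i3 : Integrable (fun _ : Ω => 2 * (1 - 25 / 36 - Real.log 2)) μ := integrable_const _
    have := integral_mono (i3.add i1) hE hp
    rw [integral_add' i3 i1, integral_const_mul (-(10 / 3))] at this
    simp only [integral_const, probReal_univ, one_smul] at this
    linarith
  rcases le_total k (4 / 3) with h | h
  · have := small k hk h
    have := Real.add_one_le_exp (k * m + 3 / 4 * k ^ 2)
    nlinarith
  rcases le_total k (5 / 2) with h' | h'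
  · obtain ⟨t, ht⟩ : ∃ t, t = (6 * k - 8) / 7 := ⟨_, rfl⟩
    have hk' : k = (7 * t + 8) / 6 := by linarith
    have t0 : 0 ≤ t := by linarith
    have t1 : t ≤ 1 := by linarith
    set a := 1 + 4 / 3 * m with ha
    set b := Real.log 2 + (5 / 2) ^ 2 / 4 with hb
    set c := (1 - t) * a + t * b with hc
    have hp : ∀ ω, Real.exp (k * X ω) ≤
        Real.exp c * (1 - t) * Real.exp (-a) * Real.exp (4 / 3 * X ω)
        + Real.exp c * t * Real.exp (-b) * Real.exp (5 / 2 * X ω) := by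
      intro ω
      have q := convexOn_exp.2 (Set.mem_univ (-a + 4 / 3 * X ω)) (Set.mem_univ (-b + 5 / 2 * X ω))
        (show 0 ≤ 1 - t by linarith) t0 (by ring)
      simp only [smul_eq_mul] at q
      have e : k * X ω = c + ((1 - t) * (-a + 4 / 3 * X ω) + t * (-b + 5 / 2 * X ω)) := by
        rw [hc, hk']; ring
      rw [e, Real.exp_add c]
      have := mul_le_mul_of_nonneg_left q (Real.exp_pos c).le
      rw [Real.exp_add (-a), Real.exp_add (-b)] at this
      linarith
    have i1 := (I (4 / 3)).const_mul (Real.exp c * (1 - t) * Real.exp (-a))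
    have i2 := (I (5 / 2)).const_mul (Real.exp c * t * Real.exp (-b))
    have := integral_mono (I k) (i1.add i2) hp
    rw [integral_add' i1 i2, integral_const_mul, integral_const_mul] at this
    have A : ∫ ω, Real.exp (4 / 3 * X ω) ∂μ ≤ Real.exp a := by
      have := small (4 / 3) (by norm_num) le_rfl
      have := Real.add_one_le_exp a
      linarith
    have B : ∫ ω, Real.exp (5 / 2 * X ω) ∂μ ≤ Real.exp b := big (5 / 2)
    have ea : Real.exp (-a) * Real.exp a = 1 := by rw [← Real.exp_add]; simp
    have eb : Real.exp (-b) * Real.exp b = 1 := by rw [← Real.exp_add]; simp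
    have A' := mul_le_mul_of_nonneg_left A
      (show 0 ≤ Real.exp c * (1 - t) * Real.exp (-a) from
        mul_nonneg (mul_nonneg (Real.exp_pos c).le (by linarith)) (Real.exp_pos _).le)
    have B' := mul_le_mul_of_nonneg_left B
      (show 0 ≤ Real.exp c * t * Real.exp (-b) by positivity)
    rw [mul_assoc _ (Real.exp (-a)) (Real.exp a), ea] at A'
    rw [mul_assoc _ (Real.exp (-b)) (Real.exp b), eb] at B'
    have fin : ∫ ω, Real.exp (k * X ω) ∂μ ≤ Real.exp c := by linarith
    refine fin.trans (Real.exp_le_exp.2 ?_)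
    have b1 : b ≤ 2.256 := by rw [hb]; norm_num; linarith
    have b2 : t * b ≤ t * 2.256 := mul_le_mul_of_nonneg_left b1 t0
    have m1 : 0 ≤ t * (m + 5 / 6) := mul_nonneg t0 (by linarith)
    rw [hc, hk', ha]
    nlinarith [sq_nonneg (t - 1 / 2)]
  · refine (big k).trans (Real.exp_le_exp.2 ?_)
    nlinarith

/-- Moment-generating-function bound: if `ψ` is integrable with `E[ψ] ≤ μ₀` and
`E[exp(ψ²/σ²)] ≤ 2`, then for every `λ ≥ 0`,
`E[exp(λψ)] ≤ exp(λμ₀ + (3/4)λ²σ²)`. -/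
theorem mgf_bound_of_subGaussian
    {Ω : Type*} [MeasurableSpace Ω] (μ : Measure Ω) [IsProbabilityMeasure μ]
    (ψ : Ω → ℝ) (hmeas : Measurable ψ)
    (σ μ₀ : ℝ) (hσ : 0 < σ)
    (hint : Integrable ψ μ) (hmean : ∫ ω, ψ ω ∂μ ≤ μ₀)
    (hsub : ∫⁻ ω, ENNReal.ofReal (Real.exp (ψ ω ^ 2 / σ ^ 2)) ∂μ ≤ 2) :
    ∀ lam : ℝ, 0 ≤ lam →
      ∫⁻ ω, ENNReal.ofReal (Real.exp (lam * ψ ω)) ∂μ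
        ≤ ENNReal.ofReal (Real.exp (lam * μ₀ + (3 / 4) * lam ^ 2 * σ ^ 2)) := by
  intro lam hl
  have hE : Integrable (fun ω => Real.exp ((ψ ω / σ) ^ 2)) μ := by
    simp only [div_pow]
    refine ⟨by fun_prop, ?_⟩
    rw [hasFiniteIntegral_iff_ofReal (ae_of_all _ fun ω => (Real.exp_pos _).le)]
    exact hsub.trans_lt (by simp)
  have h2 : ∫ ω, Real.exp ((ψ ω / σ) ^ 2) ∂μ ≤ 2 := by
    rw [integral_eq_lintegral_of_nonneg_ae (ae_of_all _ fun ω => (Real.exp_pos _).le) hE.1]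
    simp only [div_pow]
    exact ENNReal.toReal_le_of_le_ofReal (by norm_num) (by simpa using hsub)
  obtain ⟨hi, hb⟩ := aux_main μ (fun ω => ψ ω / σ) (by fun_prop) (hint.div_const σ) hE h2
    (lam * σ) (by positivity)
  have e : ∀ x : ℝ, lam * σ * (x / σ) = lam * x := by intro x; field_simp
  rw [integral_div] at hb
  simp only [e] at hi hb
  rw [← ofReal_integral_eq_lintegral_ofReal hi (ae_of_all _ fun ω => (Real.exp_pos _).le)]
  refine ENNReal.ofReal_le_ofReal (hb.trans (Real.exp_le_exp.2 ?_))
  nlinarith [mul_le_mul_of_nonneg_left hmean hl]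
end

section
/- Let C₁, C₂, C₄, C₅, C₆ > 0, C₃ ≥ 0, and let T > 0 be a real number with T ≥ max{C₃/C₄, C₁C₅/C₄², (C₁²C₆/C₄³)^{1/2}}. Define η = min{ (C₁/C₂)^{1/2}·T^{−1/2}, (C₁²/(C₄C₅))^{1/3}·T^{−2/3}, (C₁³/(C₄²C₆))^{1/5}·T^{−3/5} } and y = max{ (C₃/C₄)^{2/3}·T^{−2/3}, (C₁C₅/C₄²)^{2/3}·T^{−2/3}, (C₁²C₆/C₄³)^{2/5}·T^{−4/5} }. Then C₁/(ηT) + C₂η + C₃/(yT) + C₄·√y + C₅·η/√y + C₆·η²/y ≤ 2·(C₁C₂/T)^{1/2} + 2·(C₃C₄²/T)^{1/3} + 3·(C₁C₄C₅/T)^{1/3} + 3·(C₁²C₄²C₆/T²)^{1/5}. -/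
lemma aux_pow (a p : ℝ) (n m : ℕ) (ha : 0 ≤ a) (h : p * n = m) : (a ^ p) ^ n = a ^ m := by
  rw [← Real.rpow_mul_natCast ha, h, Real.rpow_natCast]

lemma aux_neg (a p : ℝ) (n m : ℕ) (ha : 0 ≤ a) (h : p * n = -m) : (a ^ p) ^ n = (a ^ m)⁻¹ := by
  rw [← Real.rpow_mul_natCast ha, h, Real.rpow_neg ha, Real.rpow_natCast]

lemma aux_eq (a b : ℝ) (n : ℕ) (hn : n ≠ 0) (ha : 0 ≤ a) (hb : 0 ≤ b) (h : a ^ n = b ^ n) :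
    a = b := (pow_left_inj₀ ha hb hn).1 h

/-- Optimal decoupled bound for Family 3: with the stated choices of step size
`η` and parameter `y = 1 - β`, one has
`C₁/(ηT) + C₂η + C₃/(yT) + C₄√y + C₅η/√y + C₆η²/y
  ≤ 2(C₁C₂/T)^{1/2} + 2(C₃C₄²/T)^{1/3} + 3(C₁C₄C₅/T)^{1/3} + 3(C₁²C₄²C₆/T²)^{1/5}`. -/
theorem opt_bound_family3
    (C₁ C₂ C₃ C₄ C₅ C₆ T : ℝ)
    (h1 : 0 < C₁) (h2 : 0 < C₂) (h3 : 0 ≤ C₃) (h4 : 0 < C₄) (h5 : 0 < C₅)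
    (h6 : 0 < C₆) (hT : 0 < T)
    (hTge : max (max (C₃ / C₄) (C₁ * C₅ / C₄ ^ 2))
        ((C₁ ^ 2 * C₆ / C₄ ^ 3) ^ ((1 : ℝ) / 2)) ≤ T)
    (η y : ℝ)
    (hη : η = min (min ((C₁ / C₂) ^ ((1 : ℝ) / 2) * T ^ (-(1 : ℝ) / 2))
        ((C₁ ^ 2 / (C₄ * C₅)) ^ ((1 : ℝ) / 3) * T ^ (-(2 : ℝ) / 3)))
        ((C₁ ^ 3 / (C₄ ^ 2 * C₆)) ^ ((1 : ℝ) / 5) * T ^ (-(3 : ℝ) / 5)))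
    (hy : y = max (max ((C₃ / C₄) ^ ((2 : ℝ) / 3) * T ^ (-(2 : ℝ) / 3))
        ((C₁ * C₅ / C₄ ^ 2) ^ ((2 : ℝ) / 3) * T ^ (-(2 : ℝ) / 3)))
        ((C₁ ^ 2 * C₆ / C₄ ^ 3) ^ ((2 : ℝ) / 5) * T ^ (-(4 : ℝ) / 5))) :
    C₁ / (η * T) + C₂ * η + C₃ / (y * T) + C₄ * Real.sqrt y + C₅ * η / Real.sqrt y
        + C₆ * η ^ 2 / y
      ≤ 2 * (C₁ * C₂ / T) ^ ((1 : ℝ) / 2) + 2 * (C₃ * C₄ ^ 2 / T) ^ ((1 : ℝ) / 3)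
        + 3 * (C₁ * C₄ * C₅ / T) ^ ((1 : ℝ) / 3)
        + 3 * (C₁ ^ 2 * C₄ ^ 2 * C₆ / T ^ 2) ^ ((1 : ℝ) / 5) := by
  clear hTge
  have hA2 := aux_pow (C₁ * C₂ / T) (1/2) 2 1 (by positivity) (by norm_num)
  have hB3 := aux_pow (C₃ * C₄ ^ 2 / T) (1/3) 3 1 (by positivity) (by norm_num)
  have hD3 := aux_pow (C₁ * C₄ * C₅ / T) (1/3) 3 1 (by positivity) (by norm_num)
  have hE5 := aux_pow (C₁ ^ 2 * C₄ ^ 2 * C₆ / T ^ 2) (1/5) 5 1 (by positivity) (by norm_num)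
  have hA : 0 < (C₁ * C₂ / T) ^ ((1:ℝ)/2) := by positivity
  have hB : 0 ≤ (C₃ * C₄ ^ 2 / T) ^ ((1:ℝ)/3) := by positivity
  have hD : 0 < (C₁ * C₄ * C₅ / T) ^ ((1:ℝ)/3) := by positivity
  have hE : 0 < (C₁ ^ 2 * C₄ ^ 2 * C₆ / T ^ 2) ^ ((1:ℝ)/5) := by positivity
  generalize (C₁ * C₂ / T) ^ ((1:ℝ)/2) = A at *
  generalize (C₃ * C₄ ^ 2 / T) ^ ((1:ℝ)/3) = B at *
  generalize (C₁ * C₄ * C₅ / T) ^ ((1:ℝ)/3) = D at *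
  generalize (C₁ ^ 2 * C₄ ^ 2 * C₆ / T ^ 2) ^ ((1:ℝ)/5) = E at *
  rw [pow_one] at hA2 hB3 hD3 hE5
  have e1 : (C₁ / C₂) ^ ((1 : ℝ) / 2) * T ^ (-(1 : ℝ) / 2) = C₁ / (T * A) := by
    apply aux_eq _ _ 2 (by norm_num) (by positivity) (by positivity)
    rw [mul_pow, aux_pow _ _ 2 1 (by positivity) (by norm_num),
      aux_neg _ _ 2 1 (by positivity) (by norm_num), div_pow C₁ (T * _), mul_pow T, hA2]
    field_simp
  have e2 : (C₁ ^ 2 / (C₄ * C₅)) ^ ((1 : ℝ) / 3) * T ^ (-(2 : ℝ) / 3) = C₁ / (T * D) := by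
    apply aux_eq _ _ 3 (by norm_num) (by positivity) (by positivity)
    rw [mul_pow, aux_pow _ _ 3 1 (by positivity) (by norm_num),
      aux_neg _ _ 3 2 (by positivity) (by norm_num), div_pow C₁ (T * _), mul_pow T, hD3]
    field_simp
  have e3 : (C₁ ^ 3 / (C₄ ^ 2 * C₆)) ^ ((1 : ℝ) / 5) * T ^ (-(3 : ℝ) / 5) = C₁ / (T * E) := by
    apply aux_eq _ _ 5 (by norm_num) (by positivity) (by positivity)
    rw [mul_pow, aux_pow _ _ 5 1 (by positivity) (by norm_num),
      aux_neg _ _ 5 3 (by positivity) (by norm_num), div_pow C₁ (T * _), mul_pow T, hE5]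
    field_simp
  have f1 : (C₃ / C₄) ^ ((2 : ℝ) / 3) * T ^ (-(2 : ℝ) / 3) = (B / C₄) ^ 2 := by
    apply aux_eq _ _ 3 (by norm_num) (by positivity) (by positivity)
    rw [mul_pow, aux_pow _ _ 3 2 (by positivity) (by norm_num),
      aux_neg _ _ 3 2 (by positivity) (by norm_num), pow_right_comm, div_pow B, hB3]
    field_simp
  have f2 : (C₁ * C₅ / C₄ ^ 2) ^ ((2 : ℝ) / 3) * T ^ (-(2 : ℝ) / 3) = (D / C₄) ^ 2 := by
    apply aux_eq _ _ 3 (by norm_num) (by positivity) (by positivity)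
    rw [mul_pow, aux_pow _ _ 3 2 (by positivity) (by norm_num),
      aux_neg _ _ 3 2 (by positivity) (by norm_num), pow_right_comm, div_pow D, hD3]
    field_simp
  have f3 : (C₁ ^ 2 * C₆ / C₄ ^ 3) ^ ((2 : ℝ) / 5) * T ^ (-(4 : ℝ) / 5) = (E / C₄) ^ 2 := by
    apply aux_eq _ _ 5 (by norm_num) (by positivity) (by positivity)
    rw [mul_pow, aux_pow _ _ 5 2 (by positivity) (by norm_num),
      aux_neg _ _ 5 4 (by positivity) (by norm_num), pow_right_comm, div_pow E, hE5]
    field_simp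
  rw [e1, e2, e3] at hη
  rw [f1, f2, f3] at hy
  clear e1 e2 e3 f1 f2 f3
  have hη0 : 0 < η := by rw [hη]; positivity
  have n1 : η ≤ C₁ / (T * A) := by rw [hη]; exact (min_le_left _ _).trans (min_le_left _ _)
  have n2 : η ≤ C₁ / (T * D) := by rw [hη]; exact (min_le_left _ _).trans (min_le_right _ _)
  have n3 : η ≤ C₁ / (T * E) := by rw [hη]; exact min_le_right _ _
  have y1 : (B / C₄) ^ 2 ≤ y := by rw [hy]; exact (le_max_left _ _).trans (le_max_left _ _)
  have y2 : (D / C₄) ^ 2 ≤ y := by rw [hy]; exact (le_max_right _ _).trans (le_max_left _ _)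
  have y3 : (E / C₄) ^ 2 ≤ y := by rw [hy]; exact le_max_right _ _
  have hy0 : 0 < y := lt_of_lt_of_le (by positivity) y2
  have s2 : D / C₄ ≤ √y := Real.le_sqrt_of_sq_le y2
  have t1 : C₁ / (η * T) ≤ A + D + E := by
    have key : ∀ X, 0 < X → C₁ / (C₁ / (T * X) * T) = X := by
      intro X hX; field_simp
    rcases min_choice (min (C₁ / (T * A)) (C₁ / (T * D))) (C₁ / (T * E)) with h | h
    · rcases min_choice (C₁ / (T * A)) (C₁ / (T * D)) with h' | h'
      · rw [hη, h, h', key A hA]; linarith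
      · rw [hη, h, h', key D hD]; linarith
    · rw [hη, h, key E hE]; linarith
  have t2 : C₂ * η ≤ A := by
    calc C₂ * η ≤ C₂ * (C₁ / (T * A)) := by gcongr
      _ = A ^ 2 / A := by rw [hA2]; field_simp
      _ = A := by field_simp
  have t3 : C₃ / (y * T) ≤ B := by
    rw [div_le_iff₀ (by positivity)]
    have : C₃ = B * ((B / C₄) ^ 2 * T) := by
      have : B * ((B / C₄) ^ 2 * T) = B ^ 3 * T / C₄ ^ 2 := by field_simp
      rw [this, hB3]; field_simp
    rw [this]; gcongr
  have t4 : C₄ * √y ≤ B + D + E := by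
    have key : y ≤ ((B + D + E) / C₄) ^ 2 := by
      rw [hy]
      refine max_le (max_le ?_ ?_) ?_ <;> gcongr <;> linarith
    have := Real.sqrt_le_sqrt key
    rw [Real.sqrt_sq (by positivity), le_div_iff₀ h4] at this
    linarith
  have t5 : C₅ * η / √y ≤ D := by
    calc C₅ * η / √y ≤ C₅ * (C₁ / (T * D)) / (D / C₄) := by gcongr
      _ = D ^ 3 / D ^ 2 := by rw [hD3]; field_simp
      _ = D := by field_simp
  have t6 : C₆ * η ^ 2 / y ≤ E := by
    calc C₆ * η ^ 2 / y ≤ C₆ * (C₁ / (T * E)) ^ 2 / (E / C₄) ^ 2 := by gcongr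
      _ = E ^ 5 / E ^ 4 := by rw [hE5]; field_simp
      _ = E := by field_simp
  linarith
end

section
/- Let C₁, C₂, C₄, C₅, C₆ > 0 and let T be a positive integer with T ≥ max{ √2·C₁C₅/C₄², 2·(C₁²C₆/C₄³)^{1/2} }. Define η = min{ (C₁/(C₂T))^{1/2}, (C₁²/(√2·C₄C₅T²))^{1/3}, (C₁³/(4C₄²C₆T³))^{1/5} }, let E = ⌈ min{ (C₄⁴T²/(2C₁²C₅²))^{1/3}, (C₄⁶T⁴/(16C₁⁴C₆²))^{1/5} } ⌉ (a positive integer), and set p = 1/E. Then C₁/(ηT) + C₂η + C₄·√p + C₅·η/√p + C₆·η²/p ≤ 2·(C₁C₂/T)^{1/2} + 3·(√2·C₁C₄C₅/T)^{1/3} + 5·(C₁²C₄²C₆/(8T²))^{1/5}. -/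
theorem root_aux (X : ℝ) (hX : 0 < X) (n : ℕ) (hn : n ≠ 0) (r : ℝ) (hr : r = 1 / (n : ℝ)) :
    0 < X ^ r ∧ (X ^ r) ^ n = X := by
  subst hr
  refine ⟨Real.rpow_pos_of_pos hX _, ?_⟩
  rw [one_div]
  exact Real.rpow_inv_natCast_pow hX.le hn

set_option maxHeartbeats 2000000 in
/-- Optimal bound with selection of step size, reset probability and batch size,
Family 3: with `η`, `E` and `p = 1/E` as stated,
`C₁/(ηT) + C₂η + C₄√p + C₅η/√p + C₆η²/p
  ≤ 2(C₁C₂/T)^{1/2} + 3(√2·C₁C₄C₅/T)^{1/3} + 5(C₁²C₄²C₆/(8T²))^{1/5}`. -/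
theorem opt_bound_reset_family3
    (C₁ C₂ C₄ C₅ C₆ : ℝ)
    (h1 : 0 < C₁) (h2 : 0 < C₂) (h4 : 0 < C₄) (h5 : 0 < C₅) (h6 : 0 < C₆)
    (T : ℕ) (hT : 0 < T)
    (hTge : max (Real.sqrt 2 * C₁ * C₅ / C₄ ^ 2)
        (2 * (C₁ ^ 2 * C₆ / C₄ ^ 3) ^ ((1 : ℝ) / 2)) ≤ (T : ℝ))
    (η : ℝ)
    (hη : η = min (min ((C₁ / (C₂ * T)) ^ ((1 : ℝ) / 2))
        ((C₁ ^ 2 / (Real.sqrt 2 * C₄ * C₅ * (T : ℝ) ^ 2)) ^ ((1 : ℝ) / 3)))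
        ((C₁ ^ 3 / (4 * C₄ ^ 2 * C₆ * (T : ℝ) ^ 3)) ^ ((1 : ℝ) / 5)))
    (E : ℕ) (hE : E = ⌈min
        ((C₄ ^ 4 * (T : ℝ) ^ 2 / (2 * C₁ ^ 2 * C₅ ^ 2)) ^ ((1 : ℝ) / 3))
        ((C₄ ^ 6 * (T : ℝ) ^ 4 / (16 * C₁ ^ 4 * C₆ ^ 2)) ^ ((1 : ℝ) / 5))⌉₊)
    (p : ℝ) (hp : p = 1 / (E : ℝ)) :
    C₁ / (η * T) + C₂ * η + C₄ * Real.sqrt p + C₅ * η / Real.sqrt p + C₆ * η ^ 2 / p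
      ≤ 2 * (C₁ * C₂ / T) ^ ((1 : ℝ) / 2)
        + 3 * (Real.sqrt 2 * C₁ * C₄ * C₅ / T) ^ ((1 : ℝ) / 3)
        + 5 * (C₁ ^ 2 * C₄ ^ 2 * C₆ / (8 * (T : ℝ) ^ 2)) ^ ((1 : ℝ) / 5) := by
  have ht : (0:ℝ) < T := by exact_mod_cast hT
  obtain ⟨hT1, hT2⟩ := max_le_iff.mp hTge
  have hq : 0 < Real.sqrt 2 := by positivity
  have hq2 : Real.sqrt 2 ^ 2 = 2 := Real.sq_sqrt (by norm_num)
  generalize Real.sqrt 2 = q at *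
  generalize (T:ℝ) = t at *
  obtain ⟨hk, hk2⟩ := root_aux (C₁ ^ 2 * C₆ / C₄ ^ 3) (by positivity) 2 (by norm_num) (1/2) (by norm_num)
  obtain ⟨hu, hu2⟩ := root_aux (C₁ / (C₂ * t)) (by positivity) 2 (by norm_num) (1/2) (by norm_num)
  obtain ⟨hv, hv3⟩ := root_aux (C₁ ^ 2 / (q * C₄ * C₅ * t ^ 2)) (by positivity) 3 (by norm_num) (1/3) (by norm_num)
  obtain ⟨hw, hw5⟩ := root_aux (C₁ ^ 3 / (4 * C₄ ^ 2 * C₆ * t ^ 3)) (by positivity) 5 (by norm_num) (1/5) (by norm_num)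
  obtain ⟨hx, hx3⟩ := root_aux (C₄ ^ 4 * t ^ 2 / (2 * C₁ ^ 2 * C₅ ^ 2)) (by positivity) 3 (by norm_num) (1/3) (by norm_num)
  obtain ⟨hy, hy5⟩ := root_aux (C₄ ^ 6 * t ^ 4 / (16 * C₁ ^ 4 * C₆ ^ 2)) (by positivity) 5 (by norm_num) (1/5) (by norm_num)
  obtain ⟨ha, ha2⟩ := root_aux (C₁ * C₂ / t) (by positivity) 2 (by norm_num) (1/2) (by norm_num)
  obtain ⟨hb, hb3⟩ := root_aux (q * C₁ * C₄ * C₅ / t) (by positivity) 3 (by norm_num) (1/3) (by norm_num)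
  obtain ⟨hc, hc5⟩ := root_aux (C₁ ^ 2 * C₄ ^ 2 * C₆ / (8 * t ^ 2)) (by positivity) 5 (by norm_num) (1/5) (by norm_num)
  generalize (C₁ ^ 2 * C₆ / C₄ ^ 3) ^ ((1:ℝ)/2) = k at *
  generalize (C₁ / (C₂ * t)) ^ ((1:ℝ)/2) = u at *
  generalize (C₁ ^ 2 / (q * C₄ * C₅ * t ^ 2)) ^ ((1:ℝ)/3) = v at *
  generalize (C₁ ^ 3 / (4 * C₄ ^ 2 * C₆ * t ^ 3)) ^ ((1:ℝ)/5) = w at *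
  generalize (C₄ ^ 4 * t ^ 2 / (2 * C₁ ^ 2 * C₅ ^ 2)) ^ ((1:ℝ)/3) = x at *
  generalize (C₄ ^ 6 * t ^ 4 / (16 * C₁ ^ 4 * C₆ ^ 2)) ^ ((1:ℝ)/5) = y at *
  generalize (C₁ * C₂ / t) ^ ((1:ℝ)/2) = a at *
  generalize (q * C₁ * C₄ * C₅ / t) ^ ((1:ℝ)/3) = b at *
  generalize (C₁ ^ 2 * C₄ ^ 2 * C₆ / (8 * t ^ 2)) ^ ((1:ℝ)/5) = c at *
  have hx1 : 1 ≤ x := by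
    by_contra! h
    have h3 : x ^ 3 < 1 := pow_lt_one₀ hx.le h (by norm_num)
    rw [hx3, div_lt_one (by positivity)] at h3
    rw [div_le_iff₀ (by positivity)] at hT1
    have := pow_le_pow_left₀ (by positivity) hT1 2
    have e : (q * C₁ * C₅) ^ 2 = q ^ 2 * (C₁ ^ 2 * C₅ ^ 2) := by ring
    rw [e, hq2] at this
    nlinarith
  have hy1 : 1 ≤ y := by
    by_contra! h
    have h3 : y ^ 5 < 1 := pow_lt_one₀ hy.le h (by norm_num)
    rw [hy5, div_lt_one (by positivity)] at h3
    have := pow_le_pow_left₀ (by positivity) hT2 4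
    have e : (2 * k) ^ 4 = 16 * (k ^ 2) ^ 2 := by ring
    rw [e, hk2] at this
    have e2 : 16 * (C₁ ^ 2 * C₆ / C₄ ^ 3) ^ 2 = 16 * C₁ ^ 4 * C₆ ^ 2 / C₄ ^ 6 := by
      field_simp
    rw [e2, div_le_iff₀ (by positivity)] at this
    nlinarith
  have hm1 : 1 ≤ min x y := le_min hx1 hy1
  have hEge : min x y ≤ (E:ℝ) := by rw [hE]; exact Nat.le_ceil _
  have hEle : (E:ℝ) ≤ 2 * min x y := by
    have := Nat.ceil_lt_add_one (show 0 ≤ min x y by linarith)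
    rw [← hE] at this
    linarith
  have hη0 : 0 < η := by rw [hη]; exact lt_min (lt_min hu hv) hw
  have hηu : η ≤ u := by rw [hη]; exact (min_le_left _ _).trans (min_le_left _ _)
  have hηv : η ≤ v := by rw [hη]; exact (min_le_left _ _).trans (min_le_right _ _)
  have hηw : η ≤ w := by rw [hη]; exact min_le_right _ _
  have hEx : (E:ℝ) ≤ 2 * x := hEle.trans (by linarith [min_le_left x y])
  have hEy : (E:ℝ) ≤ 2 * y := hEle.trans (by linarith [min_le_right x y])
  have hE0 : 0 < (E:ℝ) := by linarith
  have hs : 0 < Real.sqrt E := Real.sqrt_pos.mpr hE0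
  have hs2 : Real.sqrt E ^ 2 = E := Real.sq_sqrt hE0.le
  have hsp : Real.sqrt p = 1 / Real.sqrt E := by rw [hp]; simp
  rw [hsp, hp]
  clear hsp hp hE hT hTge
  generalize Real.sqrt (E:ℝ) = s at *
  generalize (E:ℝ) = e at *
  -- the pieces
  have P1 : C₁ / (u * t) = a := by
    rw [← pow_left_inj₀ (by positivity) ha.le (two_ne_zero), ha2, div_pow, mul_pow, hu2]
    field_simp
  have P2 : C₁ / (v * t) = b := by
    rw [← pow_left_inj₀ (by positivity) hb.le (three_ne_zero), hb3, div_pow, mul_pow, hv3]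
    field_simp
  have P3 : C₁ / (w * t) = 2 * c := by
    rw [← pow_left_inj₀ (by positivity) (by positivity) (show (5:ℕ) ≠ 0 by norm_num), div_pow, mul_pow, mul_pow, hc5, hw5]
    field_simp
    norm_num
  have Q1 : C₁ / (η * t) ≤ a + b + 2 * c := by
    rcases min_choice (min u v) w with h | h
    · rcases min_choice u v with h' | h'
      · rw [hη, h, h', P1]; linarith
      · rw [hη, h, h', P2]; linarith
    · rw [hη, h, P3]; linarith
  have Q2 : C₂ * η ≤ a := by
    refine (mul_le_mul_of_nonneg_left hηu h2.le).trans (le_of_eq ?_)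
    rw [← pow_left_inj₀ (by positivity) ha.le (two_ne_zero), ha2, mul_pow, hu2]
    field_simp
  have hb6 : b ^ 6 = 2 * C₁ ^ 2 * C₄ ^ 2 * C₅ ^ 2 / t ^ 2 := by
    have : b ^ 6 = (b ^ 3) ^ 2 := by ring
    rw [this, hb3, ← hq2]; field_simp
  have hc10 : c ^ 10 = (C₁ ^ 2 * C₄ ^ 2 * C₆ / (8 * t ^ 2)) ^ 2 := by
    rw [← hc5]; ring
  have hv6 : v ^ 6 = C₁ ^ 4 / (2 * C₄ ^ 2 * C₅ ^ 2 * t ^ 4) := by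
    have : v ^ 6 = (v ^ 3) ^ 2 := by ring
    rw [this, hv3, ← hq2]; field_simp
  have hs6 : s ^ 6 = e ^ 3 := by rw [← hs2]; ring
  have hs10 : s ^ 10 = e ^ 5 := by rw [← hs2]; ring
  have Q3 : C₄ * (1 / s) ≤ b + 2 * c := by
    rw [mul_one_div]
    rcases min_choice x y with h | h
    · rw [h] at hEge
      suffices C₄ / s ≤ b by linarith
      rw [div_le_iff₀ hs]
      refine le_of_pow_le_pow_left₀ (show (6:ℕ) ≠ 0 by norm_num) (by positivity) ?_
      rw [mul_pow, hs6, hb6]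
      refine le_trans (le_of_eq ?_) (mul_le_mul_of_nonneg_left (pow_le_pow_left₀ hx.le hEge 3) (by positivity))
      rw [hx3]; field_simp
    · rw [h] at hEge
      suffices C₄ / s ≤ 2 * c by linarith
      rw [div_le_iff₀ hs]
      refine le_of_pow_le_pow_left₀ (show (10:ℕ) ≠ 0 by norm_num) (by positivity) ?_
      rw [mul_pow, hs10, mul_pow, hc10]
      refine le_trans (le_of_eq ?_) (mul_le_mul_of_nonneg_left (pow_le_pow_left₀ hy.le hEge 5) (by positivity))
      rw [hy5]; field_simp; norm_num
  have Q4 : C₅ * η / (1 / s) ≤ b := by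
    rw [div_div_eq_mul_div, div_one]
    refine le_of_pow_le_pow_left₀ (show (6:ℕ) ≠ 0 by norm_num) hb.le ?_
    calc (C₅ * η * s) ^ 6 = C₅ ^ 6 * η ^ 6 * e ^ 3 := by rw [← hs6]; ring
      _ ≤ C₅ ^ 6 * v ^ 6 * (2 * x) ^ 3 := by gcongr
      _ = b ^ 6 := by rw [mul_pow, hx3, hb6, hv6]; field_simp
  have Q5 : C₆ * η ^ 2 / (1 / e) ≤ c := by
    rw [div_div_eq_mul_div, div_one]
    refine le_of_pow_le_pow_left₀ (show (5:ℕ) ≠ 0 by norm_num) hc.le ?_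
    calc (C₆ * η ^ 2 * e) ^ 5 = C₆ ^ 5 * (η ^ 5) ^ 2 * e ^ 5 := by ring
      _ ≤ C₆ ^ 5 * (w ^ 5) ^ 2 * (2 * y) ^ 5 := by gcongr
      _ = c ^ 5 := by rw [mul_pow, hy5, hc5, hw5]; field_simp; norm_num
  linarith
end

section
/- Let η > 0, w ∈ W, and u₁, u₂ ∈ E. Suppose w₁⁺ ∈ W minimizes w' ↦ ⟪η·u₁, w'⟫ + D_Φ(w', w) over W and w₂⁺ ∈ W minimizes w' ↦ ⟪η·u₂, w'⟫ + D_Φ(w', w) over W, and set P₁ = (w − w₁⁺)/η and P₂ = (w − w₂⁺)/η. Then ‖P₁ − P₂‖² ≤ ⟪u₁ − u₂, P₁ − P₂⟫ ≤ ‖u₁ − u₂‖·‖P₁ − P₂‖, and consequently ‖P₁ − P₂‖ ≤ ‖u₁ − u₂‖ (non-expansiveness of the proximal gradient mapping). -/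
open scoped RealInnerProductSpace

theorem prox_first_order {E : Type*} [NormedAddCommGroup E] [InnerProductSpace ℝ E]
    (W : Set E) (hWconv : Convex ℝ W) (Φ : E → ℝ) (Φ' : E → E)
    (hdiff : ∀ x, HasFDerivAt Φ (innerSL ℝ (Φ' x)) x) (a p v : E) (hp : p ∈ W) (hv : v ∈ W)
    (hmin : ∀ x ∈ W, ⟪a, p⟫ + Φ p ≤ ⟪a, x⟫ + Φ x) :
    0 ≤ ⟪a, v - p⟫ + ⟪Φ' p, v - p⟫ := by
  have h1 : HasFDerivAt (fun x => innerSL ℝ a x + Φ x) (innerSL ℝ a + innerSL ℝ (Φ' p)) p :=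
    (innerSL ℝ a).hasFDerivAt.add (hdiff p)
  have h2 : IsMinOn (fun x => innerSL ℝ a x + Φ x) W p := fun x hx => by
    simpa using hmin x hx
  have h3 := h2.localize.hasFDerivWithinAt_nonneg h1.hasFDerivWithinAt
    (sub_mem_posTangentConeAt_of_segment_subset (hWconv.segment_subset hp hv))
  simpa using h3

/-- Inner product bounds and non-expansiveness of the proximal gradient mapping:
if `w₁⁺`, `w₂⁺` minimize `w' ↦ ⟪η uᵢ, w'⟫ + D_Φ(w', w)` over `W` and
`Pᵢ = (w - wᵢ⁺)/η`, then
`‖P₁ - P₂‖² ≤ ⟪u₁ - u₂, P₁ - P₂⟫ ≤ ‖u₁ - u₂‖ ‖P₁ - P₂‖` and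
`‖P₁ - P₂‖ ≤ ‖u₁ - u₂‖`. -/
theorem proximal_gradient_inner_bounds_and_nonexpansive
    {E : Type*} [NormedAddCommGroup E] [InnerProductSpace ℝ E]
    (W : Set E) (hWne : W.Nonempty) (hWconv : Convex ℝ W)
    (Φ : E → ℝ) (Φ' : E → E)
    (hdiff : ∀ x, HasFDerivAt Φ (innerSL ℝ (Φ' x)) x)
    (hsc : ∀ x ∈ W, ∀ y ∈ W,
      Φ y + ⟪Φ' y, x - y⟫ + (1 / 2) * ‖x - y‖ ^ 2 ≤ Φ x)
    (D : E → E → ℝ)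
    (hD : ∀ x y, D x y = Φ x - Φ y - ⟪Φ' y, x - y⟫)
    (η : ℝ) (hη : 0 < η) (w : E) (hw : w ∈ W) (u₁ u₂ : E)
    (w₁ w₂ : E) (hw₁ : w₁ ∈ W) (hw₂ : w₂ ∈ W)
    (hmin₁ : ∀ w' ∈ W, ⟪η • u₁, w₁⟫ + D w₁ w ≤ ⟪η • u₁, w'⟫ + D w' w)
    (hmin₂ : ∀ w' ∈ W, ⟪η • u₂, w₂⟫ + D w₂ w ≤ ⟪η • u₂, w'⟫ + D w' w) :
    ∀ P₁ P₂ : E, P₁ = η⁻¹ • (w - w₁) → P₂ = η⁻¹ • (w - w₂) →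
      ‖P₁ - P₂‖ ^ 2 ≤ ⟪u₁ - u₂, P₁ - P₂⟫ ∧
      ⟪u₁ - u₂, P₁ - P₂⟫ ≤ ‖u₁ - u₂‖ * ‖P₁ - P₂‖ ∧
      ‖P₁ - P₂‖ ≤ ‖u₁ - u₂‖ := by
  rintro P₁ P₂ rfl rfl
  have f₁ := prox_first_order W hWconv Φ Φ' hdiff (η • u₁ - Φ' w) w₁ w₂ hw₁ hw₂ (fun x hx => by
    have := hmin₁ x hx
    simp only [hD, inner_sub_right, inner_sub_left] at this ⊢
    linarith)
  have f₂ := prox_first_order W hWconv Φ Φ' hdiff (η • u₂ - Φ' w) w₂ w₁ hw₂ hw₁ (fun x hx => by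
    have := hmin₂ x hx
    simp only [hD, inner_sub_right, inner_sub_left] at this ⊢
    linarith)
  have s₁ := hsc w₁ hw₁ w₂ hw₂
  have s₂ := hsc w₂ hw₂ w₁ hw₁
  rw [norm_sub_rev w₁ w₂] at s₁
  have key : ‖w₂ - w₁‖ ^ 2 ≤ η * ⟪u₁ - u₂, w₂ - w₁⟫ := by
    simp only [inner_sub_right, inner_sub_left, real_inner_smul_left] at f₁ f₂ s₁ s₂ ⊢
    linarith
  have e : η⁻¹ • (w - w₁) - η⁻¹ • (w - w₂) = η⁻¹ • (w₂ - w₁) := by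
    rw [← smul_sub]; congr 1; abel
  rw [e]
  have A : ‖η⁻¹ • (w₂ - w₁)‖ ^ 2 ≤ ⟪u₁ - u₂, η⁻¹ • (w₂ - w₁)⟫ := by
    rw [norm_smul, mul_pow, real_inner_smul_right, Real.norm_eq_abs, sq_abs]
    calc η⁻¹ ^ 2 * ‖w₂ - w₁‖ ^ 2 ≤ η⁻¹ ^ 2 * (η * ⟪u₁ - u₂, w₂ - w₁⟫) := by gcongr
      _ = _ := by field_simp
  have B := real_inner_le_norm (u₁ - u₂) (η⁻¹ • (w₂ - w₁))
  refine ⟨A, B, ?_⟩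
  by_contra! h
  have := norm_nonneg (u₁ - u₂)
  nlinarith
end

section
/- Let w ∈ W, u ∈ E, and η' > η > 0. Suppose w⁺ ∈ W minimizes w' ↦ ⟪η·u, w'⟫ + D_Φ(w', w) over W and w'⁺ ∈ W minimizes w' ↦ ⟪η'·u, w'⟫ + D_Φ(w', w) over W, and set P = (w − w⁺)/η and P' = (w − w'⁺)/η'. Then ⟪u, η'·P'⟫ ≥ ⟪u, η·P⟫ + ‖η'·P' − η·P‖²/(η' − η), and consequently ‖η'·P' − η·P‖ ≤ (η' − η)·‖u‖. -/
open scoped RealInnerProductSpace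

theorem first_order_aux
    {E : Type*} [NormedAddCommGroup E] [InnerProductSpace ℝ E]
    (W : Set E) (hWconv : Convex ℝ W)
    (Φ : E → ℝ) (Φ' : E → E)
    (hdiff : ∀ x, HasFDerivAt Φ (innerSL ℝ (Φ' x)) x)
    (b v x : E) (hv : v ∈ W) (hx : x ∈ W)
    (hmin : ∀ z ∈ W, ⟪b, v⟫ + Φ v ≤ ⟪b, z⟫ + Φ z) :
    0 ≤ ⟪b, x - v⟫ + ⟪Φ' v, x - v⟫ := by
  have h1 : IsMinOn (fun z => innerSL ℝ b z + Φ z) W v := by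
    intro z hz
    simpa using hmin z hz
  have h2 : HasFDerivAt (fun z => innerSL ℝ b z + Φ z)
      (innerSL ℝ b + innerSL ℝ (Φ' v)) v := (innerSL ℝ b).hasFDerivAt.add (hdiff v)
  have h3 := h1.localize.hasFDerivWithinAt_nonneg h2.hasFDerivWithinAt
    (sub_mem_posTangentConeAt_of_segment_subset (hWconv.segment_subset hv hx))
  simpa using h3

/-- Monotonicity of the proximal gradient mapping: for `η' > η > 0`, with
`w⁺`, `w'⁺` the minimizers of `w' ↦ ⟪η u, w'⟫ + D_Φ(w', w)` resp.
`w' ↦ ⟪η' u, w'⟫ + D_Φ(w', w)` over `W`, and `P = (w - w⁺)/η`,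
`P' = (w - w'⁺)/η'`, one has
`⟪u, η' P'⟫ ≥ ⟪u, η P⟫ + ‖η' P' - η P‖²/(η' - η)` and
`‖η' P' - η P‖ ≤ (η' - η) ‖u‖`. -/
theorem proximal_gradient_monotonicity
    {E : Type*} [NormedAddCommGroup E] [InnerProductSpace ℝ E]
    (W : Set E) (hWne : W.Nonempty) (hWconv : Convex ℝ W)
    (Φ : E → ℝ) (Φ' : E → E)
    (hdiff : ∀ x, HasFDerivAt Φ (innerSL ℝ (Φ' x)) x)
    (hsc : ∀ x ∈ W, ∀ y ∈ W,
      Φ y + ⟪Φ' y, x - y⟫ + (1 / 2) * ‖x - y‖ ^ 2 ≤ Φ x)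
    (D : E → E → ℝ)
    (hD : ∀ x y, D x y = Φ x - Φ y - ⟪Φ' y, x - y⟫)
    (η η' : ℝ) (hη : 0 < η) (hηη' : η < η')
    (w : E) (hw : w ∈ W) (u : E)
    (wp wp' : E) (hwp : wp ∈ W) (hwp' : wp' ∈ W)
    (hmin : ∀ w'' ∈ W, ⟪η • u, wp⟫ + D wp w ≤ ⟪η • u, w''⟫ + D w'' w)
    (hmin' : ∀ w'' ∈ W, ⟪η' • u, wp'⟫ + D wp' w ≤ ⟪η' • u, w''⟫ + D w'' w) :
    ∀ P P' : E, P = η⁻¹ • (w - wp) → P' = η'⁻¹ • (w - wp') →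
      ⟪u, η • P⟫ + ‖η' • P' - η • P‖ ^ 2 / (η' - η) ≤ ⟪u, η' • P'⟫ ∧
      ‖η' • P' - η • P‖ ≤ (η' - η) * ‖u‖ := by
  intro P P' hP hP'
  have hη' : 0 < η' := hη.trans hηη'
  have hd : 0 < η' - η := sub_pos.2 hηη'
  have e1 : η • P = w - wp := by rw [hP, smul_inv_smul₀ hη.ne']
  have e2 : η' • P' = w - wp' := by rw [hP', smul_inv_smul₀ hη'.ne']
  have e3 : (w - wp') - (w - wp) = wp - wp' := by abel
  rw [e1, e2, e3]
  have f1 := first_order_aux W hWconv Φ Φ' hdiff (η • u - Φ' w) wp wp' hwp hwp' (by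
    intro z hz
    have := hmin z hz
    simp only [hD, inner_sub_left, inner_sub_right] at this ⊢
    linarith)
  have f2 := first_order_aux W hWconv Φ Φ' hdiff (η' • u - Φ' w) wp' wp hwp' hwp (by
    intro z hz
    have := hmin' z hz
    simp only [hD, inner_sub_left, inner_sub_right] at this ⊢
    linarith)
  have s1 := hsc wp hwp wp' hwp'
  have s2 := hsc wp' hwp' wp hwp
  rw [norm_sub_rev wp' wp] at s2
  have key : ‖wp - wp'‖ ^ 2 ≤ (η' - η) * ⟪u, wp - wp'⟫ := by
    simp only [inner_sub_left, inner_sub_right, real_inner_smul_left] at f1 f2 s1 s2 ⊢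
    linarith
  constructor
  · have h : ‖wp - wp'‖ ^ 2 / (η' - η) ≤ ⟪u, wp - wp'⟫ := by
      rw [div_le_iff₀ hd]; linarith
    simp only [inner_sub_right] at h ⊢
    linarith
  · have cs := real_inner_le_norm u (wp - wp')
    have h := mul_le_mul_of_nonneg_left cs hd.le
    by_contra! hc
    have hpos : 0 < ‖wp - wp'‖ := lt_of_le_of_lt (by positivity) hc
    nlinarith
end

section
/- Let w ∈ W, η > 0, and u, δ ∈ E with u ≠ 0 and u + δ ≠ 0. Let w₁⁺ ∈ W be the minimizer over W of w' ↦ ⟪η·(u+δ)/‖u+δ‖, w'⟫ + D_Φ(w', w) and let w₂⁺ ∈ W be the minimizer over W of w' ↦ ⟪(η/2)·(u/‖u‖), w'⟫ + D_Φ(w', w), and set P₁ = (w − w₁⁺)/η and P₂ = (w − w₂⁺)/(η/2). Then ⟪u, P₁⟫ ≥ (1/4)·⟪u, P₂⟫ − 2‖δ‖. -/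
open scoped RealInnerProductSpace

theorem three_pt {E : Type*} [NormedAddCommGroup E] [InnerProductSpace ℝ E]
    (W : Set E) (hWconv : Convex ℝ W)
    (Φ : E → ℝ) (Φ' : E → E)
    (hdiff : ∀ x, HasFDerivAt Φ (innerSL ℝ (Φ' x)) x)
    (hsc : ∀ x ∈ W, ∀ y ∈ W,
      Φ y + ⟪Φ' y, x - y⟫ + (1 / 2) * ‖x - y‖ ^ 2 ≤ Φ x)
    (D : E → E → ℝ)
    (hD : ∀ x y, D x y = Φ x - Φ y - ⟪Φ' y, x - y⟫) (w g v : E) (hv : v ∈ W)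
    (hmin : ∀ w' ∈ W, ⟪g, v⟫ + D v w ≤ ⟪g, w'⟫ + D w' w) (x : E) (hx : x ∈ W) :
    ⟪g, v⟫ + D v w + (1 / 2) * ‖x - v‖ ^ 2 ≤ ⟪g, x⟫ + D x w := by
  have hF : HasFDerivAt (fun x => innerSL ℝ g x + (Φ x - (innerSL ℝ (Φ' w)) x))
      (innerSL ℝ g + (innerSL ℝ (Φ' v) - innerSL ℝ (Φ' w))) v :=
    (innerSL ℝ g).hasFDerivAt.add ((hdiff v).sub (innerSL ℝ (Φ' w)).hasFDerivAt)
  have hm : IsLocalMinOn (fun x => innerSL ℝ g x + (Φ x - (innerSL ℝ (Φ' w)) x)) W v := by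
    apply IsMinOn.localize
    intro y hy
    have := hmin y hy
    simp only [hD, inner_sub_right] at this
    simp only [Set.mem_setOf_eq, innerSL_apply_apply]
    linarith
  have h := hm.hasFDerivWithinAt_nonneg hF.hasFDerivWithinAt
    (sub_mem_posTangentConeAt_of_segment_subset (hWconv.segment_subset hv hx))
  have h2 := hsc x hx v hv
  simp only [ContinuousLinearMap.add_apply, ContinuousLinearMap.sub_apply, innerSL_apply_apply, inner_sub_right] at h
  simp only [hD, inner_sub_right] at h2 ⊢
  linarith

theorem normalized_sub {E : Type*} [NormedAddCommGroup E] [InnerProductSpace ℝ E]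
    (u δ : E) (hu : u ≠ 0) (huδ : u + δ ≠ 0) :
    ‖u‖ * ‖‖u + δ‖⁻¹ • (u + δ) - ‖u‖⁻¹ • u‖ ≤ 2 * ‖δ‖ := by
  have ha : ‖u‖ ≠ 0 := norm_ne_zero_iff.2 hu
  have hb : ‖u + δ‖ ≠ 0 := norm_ne_zero_iff.2 huδ
  have e : ‖u‖ • (‖u + δ‖⁻¹ • (u + δ) - ‖u‖⁻¹ • u)
      = ((‖u‖ - ‖u + δ‖) * ‖u + δ‖⁻¹) • (u + δ) + δ := by
    rw [sub_mul, mul_inv_cancel₀ hb, smul_sub, smul_smul, smul_smul, mul_inv_cancel₀ ha]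
    module
  have h1 : ‖u‖ * ‖‖u + δ‖⁻¹ • (u + δ) - ‖u‖⁻¹ • u‖
      = ‖‖u‖ • (‖u + δ‖⁻¹ • (u + δ) - ‖u‖⁻¹ • u)‖ := by
    rw [norm_smul, norm_norm]
  rw [h1, e]
  refine (norm_add_le _ _).trans ?_
  have h2 : ‖((‖u‖ - ‖u + δ‖) * ‖u + δ‖⁻¹) • (u + δ)‖ = |‖u‖ - ‖u + δ‖| := by
    rw [norm_smul, norm_mul, norm_inv, norm_norm, mul_assoc, inv_mul_cancel₀ hb, mul_one,
      Real.norm_eq_abs]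
  have h3 := abs_norm_sub_norm_le u (u + δ)
  have h4 : ‖u - (u + δ)‖ = ‖δ‖ := by
    rw [sub_add_cancel_left, norm_neg]
  rw [h2]; linarith

set_option maxHeartbeats 1000000 in
/-- Bound for the proximal gradient mapping with normalized direction:
if `w₁⁺` minimizes `w' ↦ ⟪η (u+δ)/‖u+δ‖, w'⟫ + D_Φ(w', w)` and `w₂⁺` minimizes
`w' ↦ ⟪(η/2) u/‖u‖, w'⟫ + D_Φ(w', w)` over `W`, with `P₁ = (w - w₁⁺)/η` and
`P₂ = (w - w₂⁺)/(η/2)`, then `⟪u, P₁⟫ ≥ (1/4)⟪u, P₂⟫ - 2‖δ‖`. -/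
theorem proximal_gradient_normalized_direction_bound
    {E : Type*} [NormedAddCommGroup E] [InnerProductSpace ℝ E] [CompleteSpace E]
    (W : Set E) (hWne : W.Nonempty) (hWconv : Convex ℝ W) (hWclosed : IsClosed W)
    (Φ : E → ℝ) (hΦcont : Continuous Φ) (Φ' : E → E)
    (hdiff : ∀ x, HasFDerivAt Φ (innerSL ℝ (Φ' x)) x)
    (hsc : ∀ x ∈ W, ∀ y ∈ W,
      Φ y + ⟪Φ' y, x - y⟫ + (1 / 2) * ‖x - y‖ ^ 2 ≤ Φ x)
    (D : E → E → ℝ)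
    (hD : ∀ x y, D x y = Φ x - Φ y - ⟪Φ' y, x - y⟫)
    (η : ℝ) (hη : 0 < η) (w : E) (hw : w ∈ W)
    (u δ : E) (hu : u ≠ 0) (huδ : u + δ ≠ 0)
    (w₁ w₂ : E) (hw₁ : w₁ ∈ W) (hw₂ : w₂ ∈ W)
    (hmin₁ : ∀ w' ∈ W,
      ⟪η • (‖u + δ‖⁻¹ • (u + δ)), w₁⟫ + D w₁ w
        ≤ ⟪η • (‖u + δ‖⁻¹ • (u + δ)), w'⟫ + D w' w)
    (hmin₂ : ∀ w' ∈ W,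
      ⟪(η / 2) • (‖u‖⁻¹ • u), w₂⟫ + D w₂ w
        ≤ ⟪(η / 2) • (‖u‖⁻¹ • u), w'⟫ + D w' w) :
    ∀ P₁ P₂ : E, P₁ = η⁻¹ • (w - w₁) → P₂ = (η / 2)⁻¹ • (w - w₂) →
      (1 / 4) * ⟪u, P₂⟫ - 2 * ‖δ‖ ≤ ⟪u, P₁⟫ := by
  rintro P₁ P₂ rfl rfl
  have T := three_pt W hWconv Φ Φ' hdiff hsc D hD w
  have A1 := T _ w₁ hw₁ hmin₁
  have A2 := T _ w₂ hw₂ hmin₂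
  have hE := normalized_sub u δ hu huδ
  have ha : 0 < ‖u‖ := norm_pos_iff.2 hu
  have hb : 0 < ‖u + δ‖ := norm_pos_iff.2 huδ
  have hg1 : ‖‖u + δ‖⁻¹ • (u + δ)‖ = 1 := by
    rw [norm_smul, norm_inv, norm_norm, inv_mul_cancel₀ hb.ne']
  have hg2 : ‖‖u‖⁻¹ • u‖ = 1 := by
    rw [norm_smul, norm_inv, norm_norm, inv_mul_cancel₀ ha.ne']
  have hug : u = ‖u‖ • (‖u‖⁻¹ • u) := by
    rw [smul_smul, mul_inv_cancel₀ ha.ne', one_smul]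
  generalize ‖u + δ‖⁻¹ • (u + δ) = g₁ at *
  generalize ‖u‖⁻¹ • u = g₂ at *
  have hDw : D w w = 0 := by simp [hD]
  have hDl : ∀ x ∈ W, (1 / 2) * ‖w - x‖ ^ 2 ≤ D x w := by
    intro x hx
    have := hsc x hx w hw
    rw [hD, norm_sub_rev w x]; linarith
  have B1 := A1 w hw
  have B2 := A2 w hw
  have C1 := A1 w₂ hw₂
  have C2 := A2 w₁ hw₁
  have d1 := hDl _ hw₁
  have d2 := hDl _ hw₂
  rw [norm_sub_rev w₁ w₂] at C2
  have e1 : ⟪g₁, w - w₁⟫ ≤ ‖w - w₁‖ := by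
    simpa [hg1] using real_inner_le_norm g₁ (w - w₁)
  have e2 : ⟪g₂, w - w₂⟫ ≤ ‖w - w₂‖ := by
    simpa [hg2] using real_inner_le_norm g₂ (w - w₂)
  have e3 := real_inner_le_norm (g₁ - g₂) (w₂ - w₁)
  have e4 : -‖w - w₁‖ ≤ ⟪g₂, w - w₁⟫ := by
    have := abs_le.1 (abs_real_inner_le_norm g₂ (w - w₁))
    simpa [hg2] using this.1
  have k1 : ‖w - w₁‖ ^ 2 ≤ η * ⟪g₁, w - w₁⟫ := by
    simp only [real_inner_smul_left, inner_sub_right] at *; linarith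
  have k2 : ‖w - w₂‖ ^ 2 ≤ η / 2 * ⟪g₂, w - w₂⟫ := by
    simp only [real_inner_smul_left, inner_sub_right] at *; linarith
  have k3 : ‖w₂ - w₁‖ ^ 2 ≤ η / 2 * ⟪g₂, w₂ - w₁⟫ + η * ⟪g₁ - g₂, w₂ - w₁⟫ := by
    simp only [real_inner_smul_left, inner_sub_right, inner_sub_left] at *; linarith
  have n1 : ‖w - w₁‖ ≤ η := by
    by_contra hc
    nlinarith [norm_nonneg (w - w₁)]
  have n2 : ‖w - w₂‖ ≤ η / 2 := by
    by_contra hc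
    nlinarith [norm_nonneg (w - w₂)]
  have p2 : 0 ≤ ⟪g₂, w - w₂⟫ := by
    by_contra hc
    nlinarith [sq_nonneg ‖w - w₂‖]
  have split : ⟪g₂, w - w₁⟫ = ⟪g₂, w - w₂⟫ + ⟪g₂, w₂ - w₁⟫ := by
    rw [← inner_add_right]; congr 1; abel
  have key : 1 / 2 * (‖u‖ * ⟪g₂, w - w₂⟫) - 2 * ‖δ‖ * η ≤ ‖u‖ * ⟪g₂, w - w₁⟫ := by
    by_cases hδ : ‖δ‖ ≤ ‖u‖
    · have q : -(η * ‖g₁ - g₂‖ ^ 2 / 2) ≤ ⟪g₂, w₂ - w₁⟫ := by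
        by_contra hc
        push Not at hc
        nlinarith [sq_nonneg (‖w₂ - w₁‖ - η * ‖g₁ - g₂‖ / 2), mul_le_mul_of_nonneg_left e3 hη.le,
          mul_lt_mul_of_pos_left hc hη]
      have r : ‖u‖ * ‖g₁ - g₂‖ ^ 2 ≤ 4 * ‖δ‖ := by
        have r1 : ‖g₁ - g₂‖ ≤ 2 := by
          have := norm_sub_le g₁ g₂
          linarith
        nlinarith [norm_nonneg (g₁ - g₂)]
      rw [split, mul_add]
      linarith [mul_le_mul_of_nonneg_left q ha.le, mul_le_mul_of_nonneg_left r hη.le,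
        mul_nonneg ha.le p2]
    · push Not at hδ
      have s1 : -η ≤ ⟪g₂, w - w₁⟫ := by linarith
      have s2 : ⟪g₂, w - w₂⟫ ≤ η / 2 := by linarith
      linarith [mul_le_mul_of_nonneg_left s1 ha.le, mul_le_mul_of_nonneg_left s2 ha.le,
        mul_lt_mul_of_pos_right hδ hη, mul_pos ha hη]
  have i1 : ∀ y : E, ⟪u, y⟫ = ‖u‖ * ⟪g₂, y⟫ := by
    intro y
    conv_lhs => rw [hug]
    rw [real_inner_smul_left]
  rw [real_inner_smul_right, real_inner_smul_right, i1, i1]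
  have f : ‖u‖ * ⟪g₂, w - w₁⟫ = η * (η⁻¹ * (‖u‖ * ⟪g₂, w - w₁⟫)) := by field_simp
  have f2 : 1 / 2 * (‖u‖ * ⟪g₂, w - w₂⟫)
    = η * (1 / 4 * ((η / 2)⁻¹ * (‖u‖ * ⟪g₂, w - w₂⟫))) := by field_simp; ring
  rw [f, f2] at key
  refine le_of_mul_le_mul_left ?_ hη
  linarith
end

section
/- Assume additionally that D_Φ(x, y) ≤ R²/2 for all x, y ∈ W. Let η > 0, let T ≥ 1 be an integer, let U₁, …, U_T ∈ E satisfy ‖U_t‖ ≤ G for all t, let w₁ ∈ W, and for each t let w_{t+1} ∈ W be a minimizer over W of w ↦ ⟪η·U_t, w⟫ + D_Φ(w, w_t). Then for every w* ∈ W, Σ_{t=1}^T ⟪U_t, w_t − w*⟫ ≤ R²/(2η) + η·T·G²/2. -/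
open scoped RealInnerProductSpace

/-- Mirror-descent regret summation: if `D_Φ(x,y) ≤ R²/2` on `W`, `‖U_t‖ ≤ G`,
and each `w_{t+1} ∈ W` minimizes `w ↦ ⟪η U_t, w⟫ + D_Φ(w, w_t)` over `W`, then
for every `w* ∈ W`, `∑_{t=1}^T ⟪U_t, w_t - w*⟫ ≤ R²/(2η) + η T G²/2`. -/
theorem mirror_descent_regret_sum
    {E : Type*} [NormedAddCommGroup E] [InnerProductSpace ℝ E]
    (W : Set E) (hWne : W.Nonempty) (hWconv : Convex ℝ W)
    (Φ : E → ℝ) (Φ' : E → E)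
    (hdiff : ∀ x, HasFDerivAt Φ (innerSL ℝ (Φ' x)) x)
    (hsc : ∀ x ∈ W, ∀ y ∈ W,
      Φ y + ⟪Φ' y, x - y⟫ + (1 / 2) * ‖x - y‖ ^ 2 ≤ Φ x)
    (D : E → E → ℝ)
    (hD : ∀ x y, D x y = Φ x - Φ y - ⟪Φ' y, x - y⟫)
    (R G : ℝ) (hR : 0 < R) (hG : 0 ≤ G)
    (hDbound : ∀ x ∈ W, ∀ y ∈ W, D x y ≤ R ^ 2 / 2)
    (η : ℝ) (hη : 0 < η) (T : ℕ) (hT : 1 ≤ T)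
    (U : ℕ → E) (hU : ∀ t ∈ Finset.Icc 1 T, ‖U t‖ ≤ G)
    (w : ℕ → E) (hw1 : w 1 ∈ W)
    (hwmem : ∀ t ∈ Finset.Icc 1 T, w (t + 1) ∈ W)
    (hmin : ∀ t ∈ Finset.Icc 1 T, ∀ w' ∈ W,
      ⟪η • U t, w (t + 1)⟫ + D (w (t + 1)) (w t)
        ≤ ⟪η • U t, w'⟫ + D w' (w t)) :
    ∀ wstar ∈ W,
      ∑ t ∈ Finset.Icc 1 T, ⟪U t, w t - wstar⟫
        ≤ R ^ 2 / (2 * η) + η * T * G ^ 2 / 2 := by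
  intro u hu
  have hwW : ∀ t ∈ Finset.Icc 1 (T + 1), w t ∈ W := by
    intro t ht
    rw [Finset.mem_Icc] at ht
    rcases Nat.eq_or_lt_of_le ht.1 with h | h
    · rw [← h]; exact hw1
    · have := hwmem (t - 1) (by rw [Finset.mem_Icc]; omega)
      rwa [Nat.sub_add_cancel ht.1] at this
  have step : ∀ t ∈ Finset.Icc 1 T,
      η * ⟪U t, w t - u⟫ ≤ D u (w t) - D u (w (t + 1)) + η ^ 2 * G ^ 2 / 2 := by
    intro t ht
    have hp := hwmem t ht
    have hc : w t ∈ W := hwW t (by rw [Finset.mem_Icc] at *; omega)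
    have hder : HasFDerivAt (fun x => ⟪η • U t, x⟫ + D x (w t))
        (innerSL ℝ (η • U t) + (innerSL ℝ (Φ' (w (t + 1))) - innerSL ℝ (Φ' (w t))))
        (w (t + 1)) := by
      simp only [hD]
      refine HasFDerivAt.add (innerSL ℝ (η • U t)).hasFDerivAt
        (HasFDerivAt.sub ((hdiff _).sub_const _) ?_)
      exact (innerSL ℝ (Φ' (w t))).hasFDerivAt.comp (w (t + 1)) ((hasFDerivAt_id _).sub_const (w t))
    have hloc : IsLocalMinOn (fun x => ⟪η • U t, x⟫ + D x (w t)) W (w (t + 1)) :=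
      IsMinOn.localize (fun x hx => hmin t ht x hx)
    have h0 := hloc.hasFDerivWithinAt_nonneg hder.hasFDerivWithinAt
      (sub_mem_posTangentConeAt_of_segment_subset (hWconv.segment_subset hp hu))
    simp only [ContinuousLinearMap.add_apply, ContinuousLinearMap.sub_apply,
      innerSL_apply_apply, inner_smul_left, inner_sub_right] at h0
    have h1 := hsc _ hp _ hc
    have h2 := real_inner_le_norm (U t) (w t - w (t + 1))
    have h3 : ‖U t‖ * ‖w t - w (t + 1)‖ ≤ G * ‖w t - w (t + 1)‖ :=
      mul_le_mul_of_nonneg_right (hU t ht) (norm_nonneg _)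
    have h4 := mul_le_mul_of_nonneg_left (h2.trans h3) hη.le
    rw [norm_sub_rev] at h1
    have h5 := sq_nonneg (η * G - ‖w t - w (t + 1)‖)
    simp only [hD, inner_sub_right] at *
    simp at h0
    nlinarith
  have hsum : ∀ n : ℕ, n ≤ T → η * ∑ t ∈ Finset.Icc 1 n, ⟪U t, w t - u⟫
      ≤ D u (w 1) - D u (w (n + 1)) + n * (η ^ 2 * G ^ 2 / 2) := by
    intro n
    induction n with
    | zero => intro _; simp
    | succ k ih =>
      intro hk
      rw [Finset.sum_Icc_succ_top (by omega), mul_add]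
      have a := ih (by omega)
      have b := step (k + 1) (by rw [Finset.mem_Icc]; omega)
      push_cast
      linarith
  have hf := hsum T le_rfl
  have hb := hDbound u hu _ hw1
  have hT1 := hwmem T (by rw [Finset.mem_Icc]; omega)
  have hn : 0 ≤ D u (w (T + 1)) := by
    have := hsc u hu _ hT1
    rw [hD]
    nlinarith [sq_nonneg ‖u - w (T + 1)‖]
  have he : R ^ 2 / (2 * η) + η * T * G ^ 2 / 2
      = (R ^ 2 / 2 + T * (η ^ 2 * G ^ 2 / 2)) / η := by
    field_simp
  rw [he, le_div_iff₀ hη]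
  linarith
end

section
/- Let T ≥ 1, let w₁, …, w_T ∈ W, let w* ∈ W, and let v_t, e_t ∈ ℝ for t = 1, …, T satisfy h(w_t) = v_t − e_t and |e_t| ≤ ℰ for all t, where ℰ ≥ 0. Let ε ∈ ℝ, define A = { t ∈ {1,…,T} : v_t ≤ ε } and B = {1,…,T} \ A, and assume (1/T)·Σ_{t∈A} (f(w_t) − f(w*)) + (1/T)·Σ_{t∈B} v_t ≤ ε. Then A is non-empty, and the average w̄ = (1/|A|)·Σ_{t∈A} w_t satisfies f(w̄) − f(w*) ≤ ε and h(w̄) ≤ ε + ℰ. -/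
/-- Selected-average guarantee for the switching gradient method: if
`h(w_t) = v_t - e_t` with `|e_t| ≤ ℰ`, `A = {t ∈ [T] : v_t ≤ ε}`,
`B = [T] \ A`, and `(1/T)∑_{t∈A}(f(w_t) - f(w*)) + (1/T)∑_{t∈B} v_t ≤ ε`,
then `A` is non-empty and the average `w̄ = (1/|A|)∑_{t∈A} w_t` satisfies
`f(w̄) - f(w*) ≤ ε` and `h(w̄) ≤ ε + ℰ`. -/
theorem switching_selected_average_guarantee
    {E : Type*} [AddCommGroup E] [Module ℝ E]
    (W : Set E) (hWne : W.Nonempty) (hWconv : Convex ℝ W)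
    (f h : E → ℝ) (hfconv : ConvexOn ℝ W f) (hhconv : ConvexOn ℝ W h)
    (T : ℕ) (hT : 1 ≤ T)
    (w : ℕ → E) (hwmem : ∀ t ∈ Finset.Icc 1 T, w t ∈ W)
    (wstar : E) (hwstar : wstar ∈ W)
    (v e : ℕ → ℝ) (ℰ : ℝ) (hℰ : 0 ≤ ℰ)
    (hve : ∀ t ∈ Finset.Icc 1 T, h (w t) = v t - e t)
    (hebd : ∀ t ∈ Finset.Icc 1 T, |e t| ≤ ℰ)
    (ε : ℝ)
    (A : Finset ℕ) (hA : A = (Finset.Icc 1 T).filter fun t => v t ≤ ε)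
    (B : Finset ℕ) (hB : B = Finset.Icc 1 T \ A)
    (hsum : (1 / (T : ℝ)) * ∑ t ∈ A, (f (w t) - f wstar)
        + (1 / (T : ℝ)) * ∑ t ∈ B, v t ≤ ε) :
    A.Nonempty ∧
      f ((A.card : ℝ)⁻¹ • ∑ t ∈ A, w t) - f wstar ≤ ε ∧
      h ((A.card : ℝ)⁻¹ • ∑ t ∈ A, w t) ≤ ε + ℰ := by
  have hTpos : (0 : ℝ) < T := by exact_mod_cast hT
  have hAsub : A ⊆ Finset.Icc 1 T := by rw [hA]; exact Finset.filter_subset _ _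
  have hcard : (B.card : ℝ) + A.card = T := by
    have h1 := Finset.card_sdiff_add_card_eq_card hAsub
    rw [← hB, Nat.card_Icc, Nat.add_sub_cancel] at h1
    exact_mod_cast h1
  have hBv : ∀ t ∈ B, ε < v t := by
    intro t ht
    rw [hB, Finset.mem_sdiff] at ht
    by_contra hc
    apply ht.2
    rw [hA, Finset.mem_filter]
    exact ⟨ht.1, not_lt.mp hc⟩
  have hsum2 : ∑ t ∈ A, (f (w t) - f wstar) + ∑ t ∈ B, v t ≤ T * ε := by
    rw [← mul_add, one_div, inv_mul_le_iff₀ hTpos] at hsum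
    exact hsum
  have hne : A.Nonempty := by
    by_contra hc
    rw [Finset.not_nonempty_iff_eq_empty] at hc
    have hBc : (B.card : ℝ) = T := by simpa [hc] using hcard
    have hBne : B.Nonempty := by
      rw [← Finset.card_pos]
      exact_mod_cast hBc ▸ hTpos
    have h2 : ∑ t ∈ B, ε < ∑ t ∈ B, v t := Finset.sum_lt_sum_of_nonempty hBne hBv
    rw [Finset.sum_const, nsmul_eq_mul, hBc] at h2
    simp only [hc, Finset.sum_empty, zero_add] at hsum2
    linarith
  have hcpos : (0 : ℝ) < A.card := by exact_mod_cast hne.card_pos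
  have jensen : ∀ g : E → ℝ, ConvexOn ℝ W g → ∀ c : ℝ,
      ∑ t ∈ A, g (w t) ≤ A.card * c → g ((A.card : ℝ)⁻¹ • ∑ t ∈ A, w t) ≤ c := by
    intro g hg c hc
    have h3 := hg.map_sum_le (t := A) (w := fun _ => (A.card : ℝ)⁻¹) (p := w)
      (fun _ _ => by positivity)
      (by rw [Finset.sum_const, nsmul_eq_mul, mul_inv_cancel₀ hcpos.ne'])
      (fun t ht => hwmem t (hAsub ht))
    rw [← Finset.smul_sum, ← Finset.smul_sum, smul_eq_mul] at h3
    exact h3.trans ((inv_mul_le_iff₀ hcpos).2 hc)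
  refine ⟨hne, ?_, ?_⟩
  · rw [sub_le_iff_le_add]
    apply jensen f hfconv
    have h2 : ∑ t ∈ B, ε ≤ ∑ t ∈ B, v t := Finset.sum_le_sum fun t ht => (hBv t ht).le
    rw [Finset.sum_const, nsmul_eq_mul] at h2
    rw [Finset.sum_sub_distrib, Finset.sum_const, nsmul_eq_mul, ← hcard] at hsum2
    linarith
  · apply jensen h hhconv
    rw [← nsmul_eq_mul]
    apply Finset.sum_le_card_nsmul
    intro t ht
    have h4 := neg_le_of_abs_le (hebd t (hAsub ht))
    rw [hve t (hAsub ht)]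
    rw [hA, Finset.mem_filter] at ht
    linarith [ht.2]
end
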